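/- arXiv:1002.1110 — 2 statements merged into one kernel-verified Lean document; each statement's English description precedes it below -/
import Mathlib

section
/- Let Ω = I × J ⊂ ℝ² be an open rectangle, let p and q be real-valued functions on Ω with p twice continuously differentiable and p > 0 on Ω, let u₀ be a positive twice continuously differentiable solution of div(p grad u₀) + q u₀ = 0 on Ω, set f = p^{1/2} u₀ and q₁ = −(1/p)( q/p + 2⟨∇p/p, ∇u₀/u₀⟩ + 2|∇u₀/u₀|² ). Let v be a real-valued twice continuously differentiable solution of div((1/p) grad v) + q₁ v = 0 on Ω. Write i·p^{−1}·u₀^{−2}·∂_z̄(u₀ v) = Ψ₁ + iΨ₂ with Ψ₁, Ψ₂ real-valued, fix (x₀,y₀) ∈ Ω and c ∈ ℝ, and define u(x,y) = −u₀(x,y) · ( 2( ∫_{x₀}^{x} Ψ₁(η,y) dη + ∫_{y₀}^{y} Ψ₂(x₀,ξ) dξ ) + c ). Then u satisfies div(p grad u) + q u = 0 on Ω, and the function W = p^{1/2} u + i p^{−1/2} v is a solution of the main Vekua equation ∂_z̄ W = (∂_z̄ f / f)·conj(W) on Ω. -/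
open Complex

/-- Partial derivative in `x` of a complex-valued function on `ℝ²`. -/
noncomputable def pdx (f : ℝ × ℝ → ℂ) (z : ℝ × ℝ) : ℂ := fderiv ℝ f z (1, 0)

/-- Partial derivative in `y` of a complex-valued function on `ℝ²`. -/
noncomputable def pdy (f : ℝ × ℝ → ℂ) (z : ℝ × ℝ) : ℂ := fderiv ℝ f z (0, 1)

/-- The Wirtinger derivative `∂_z̄ = ½(∂_x + i∂_y)`. -/
noncomputable def dzbar (f : ℝ × ℝ → ℂ) (z : ℝ × ℝ) : ℂ :=
  (1 / 2 : ℂ) * (pdx f z + Complex.I * pdy f z)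

/-- The Wirtinger derivative `∂_z = ½(∂_x − i∂_y)`. -/
noncomputable def dz (f : ℝ × ℝ → ℂ) (z : ℝ × ℝ) : ℂ :=
  (1 / 2 : ℂ) * (pdx f z - Complex.I * pdy f z)

/-- Partial derivative in `x` of a real-valued function on `ℝ²`. -/
noncomputable def rpdx (f : ℝ × ℝ → ℝ) (z : ℝ × ℝ) : ℝ := fderiv ℝ f z (1, 0)

/-- Partial derivative in `y` of a real-valued function on `ℝ²`. -/
noncomputable def rpdy (f : ℝ × ℝ → ℝ) (z : ℝ × ℝ) : ℝ := fderiv ℝ f z (0, 1)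

/-- `div(p grad u) = ∂_x(p ∂_x u) + ∂_y(p ∂_y u)`. -/
noncomputable def divPgrad (p u : ℝ × ℝ → ℝ) (z : ℝ × ℝ) : ℝ :=
  rpdx (fun w => p w * rpdx u w) z + rpdy (fun w => p w * rpdy u w) z

/-- Coercion of a real-valued function on `ℝ²` to a complex-valued one. -/
noncomputable def cof (f : ℝ × ℝ → ℝ) : ℝ × ℝ → ℂ := fun z => ((f z : ℝ) : ℂ)

/-- A closed `1`-form `A dx + B dy` on an open convex subset of the plane is exact. -/
lemma exists_hasFDerivAt_of_rpdy_eq_rpdx {S : Set (ℝ × ℝ)} (hS : Convex ℝ S) (hSo : IsOpen S)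
    {A B : ℝ × ℝ → ℝ} (hA : DifferentiableOn ℝ A S) (hB : DifferentiableOn ℝ B S)
    (hAB : ∀ z ∈ S, rpdy A z = rpdx B z) :
    ∃ F : ℝ × ℝ → ℝ, ∀ z ∈ S, HasFDerivAt F
      (A z • ContinuousLinearMap.fst ℝ ℝ ℝ + B z • ContinuousLinearMap.snd ℝ ℝ ℝ) z := by
  have hω : ∀ z ∈ S, HasFDerivAt
      (fun z => A z • ContinuousLinearMap.fst ℝ ℝ ℝ + B z • ContinuousLinearMap.snd ℝ ℝ ℝ)
      ((fderiv ℝ A z).smulRight (ContinuousLinearMap.fst ℝ ℝ ℝ) +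
        (fderiv ℝ B z).smulRight (ContinuousLinearMap.snd ℝ ℝ ℝ)) z := fun z hz =>
    ((hA.differentiableAt (hSo.mem_nhds hz)).hasFDerivAt.smul_const
      (ContinuousLinearMap.fst ℝ ℝ ℝ)).add
      ((hB.differentiableAt (hSo.mem_nhds hz)).hasFDerivAt.smul_const
        (ContinuousLinearMap.snd ℝ ℝ ℝ))
  refine hS.exists_forall_hasFDerivAt_of_fderiv_symmetric hSo
    (fun z hz => (hω z hz).differentiableAt.differentiableWithinAt) fun z hz a b => ?_
  have hsplit : ∀ (L : ℝ × ℝ →L[ℝ] ℝ) (w : ℝ × ℝ), L w = w.1 * L (1, 0) + w.2 * L (0, 1) := by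
    intro L w
    rw [← smul_eq_mul, ← smul_eq_mul, ← map_smul, ← map_smul, ← map_add]
    simp
  have h := hAB z hz
  simp only [rpdx, rpdy] at h
  rw [(hω z hz).fderiv]
  simp only [add_apply, ContinuousLinearMap.smulRight_apply,
    smul_apply, ContinuousLinearMap.coe_fst', ContinuousLinearMap.coe_snd',
    smul_eq_mul]
  rw [hsplit (fderiv ℝ A z) a, hsplit (fderiv ℝ A z) b, hsplit (fderiv ℝ B z) a,
    hsplit (fderiv ℝ B z) b, h]
  ring

/-- A primitive of `A dx + B dy` on a rectangle is recovered by integrating along an `L`-shaped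
path. -/
lemma integral_add_integral_eq_sub_of_hasFDerivAt {a₁ a₂ b₁ b₂ : ℝ} {A B F : ℝ × ℝ → ℝ}
    (hA : ContinuousOn A (Set.Ioo a₁ a₂ ×ˢ Set.Ioo b₁ b₂))
    (hB : ContinuousOn B (Set.Ioo a₁ a₂ ×ˢ Set.Ioo b₁ b₂))
    (hF : ∀ z ∈ Set.Ioo a₁ a₂ ×ˢ Set.Ioo b₁ b₂, HasFDerivAt F
      (A z • ContinuousLinearMap.fst ℝ ℝ ℝ + B z • ContinuousLinearMap.snd ℝ ℝ ℝ) z)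
    {x₀ y₀ x y : ℝ} (h₀ : (x₀, y₀) ∈ Set.Ioo a₁ a₂ ×ˢ Set.Ioo b₁ b₂)
    (h : (x, y) ∈ Set.Ioo a₁ a₂ ×ˢ Set.Ioo b₁ b₂) :
    (∫ η in x₀..x, A (η, y)) + ∫ ξ in y₀..y, B (x₀, ξ) = F (x, y) - F (x₀, y₀) := by
  have hx : ∀ η ∈ Set.uIcc x₀ x, (η, y) ∈ Set.Ioo a₁ a₂ ×ˢ Set.Ioo b₁ b₂ := fun η hη =>
    ⟨Set.OrdConnected.uIcc_subset Set.ordConnected_Ioo h₀.1 h.1 hη, h.2⟩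
  have hy : ∀ ξ ∈ Set.uIcc y₀ y, (x₀, ξ) ∈ Set.Ioo a₁ a₂ ×ˢ Set.Ioo b₁ b₂ := fun ξ hξ =>
    ⟨h₀.1, Set.OrdConnected.uIcc_subset Set.ordConnected_Ioo h₀.2 h.2 hξ⟩
  have h1 : ∫ η in x₀..x, A (η, y) = F (x, y) - F (x₀, y) := by
    refine intervalIntegral.integral_eq_sub_of_hasDerivAt (f := fun η => F (η, y))
      (fun η hη => ?_) (ContinuousOn.intervalIntegrable ?_)
    · simpa [Function.comp_def] using (hF _ (hx η hη)).comp_hasDerivAt η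
        ((hasDerivAt_id η).prodMk (hasDerivAt_const η y))
    · exact hA.comp (by fun_prop) hx
  have h2 : ∫ ξ in y₀..y, B (x₀, ξ) = F (x₀, y) - F (x₀, y₀) := by
    refine intervalIntegral.integral_eq_sub_of_hasDerivAt (f := fun ξ => F (x₀, ξ))
      (fun ξ hξ => ?_) (ContinuousOn.intervalIntegrable ?_)
    · simpa [Function.comp_def] using (hF _ (hy ξ hξ)).comp_hasDerivAt ξ
        ((hasDerivAt_const ξ x₀).prodMk (hasDerivAt_id ξ))
    · exact hB.comp (by fun_prop) hy
  rw [h1, h2]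
  ring

section DirectionalDerivatives

variable {E : Type*} [NormedAddCommGroup E] [NormedSpace ℝ E]

lemma ContDiffOn.differentiableOn_fderiv_apply {S : Set E} (hS : IsOpen S) {g : E → ℝ}
    (hg : ContDiffOn ℝ 2 g S) (e : E) : DifferentiableOn ℝ (fun z => fderiv ℝ g z e) S :=
  ((hg.fderiv_of_isOpen hS (m := 1) (by norm_num)).differentiableOn (by norm_num)).clm_apply
    (differentiableOn_const e)

lemma fderiv_mul_apply_of_differentiableAt {g h : E → ℝ} {z : E} (hg : DifferentiableAt ℝ g z)
    (hh : DifferentiableAt ℝ h z) (e : E) :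
    fderiv ℝ (fun w => g w * h w) z e = g z * fderiv ℝ h z e + h z * fderiv ℝ g z e := by
  simp [fderiv_fun_mul hg hh]

lemma fderiv_inv_apply_of_differentiableAt {g : E → ℝ} {z : E} (hg : DifferentiableAt ℝ g z)
    (h0 : g z ≠ 0) (e : E) :
    fderiv ℝ (fun w => (g w)⁻¹) z e = -fderiv ℝ g z e / g z ^ 2 := by
  have h := (hasDerivAt_inv h0).comp_hasFDerivAt z hg.hasFDerivAt
  refine (congrArg (· e) h.fderiv).trans ?_
  simp
  ring

lemma DifferentiableOn.div_of_ne_zero {g h : E → ℝ} {S : Set E} (hg : DifferentiableOn ℝ g S)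
    (hh : DifferentiableOn ℝ h S) (h0 : ∀ z ∈ S, h z ≠ 0) :
    DifferentiableOn ℝ (fun z => g z / h z) S := by
  simpa only [div_eq_mul_inv] using hg.fun_mul (hh.fun_inv h0)

lemma fderiv_div_apply_of_differentiableAt {g h : E → ℝ} {z : E} (hg : DifferentiableAt ℝ g z)
    (hh : DifferentiableAt ℝ h z) (h0 : h z ≠ 0) (e : E) :
    fderiv ℝ (fun w => g w / h w) z e =
      (fderiv ℝ g z e * h z - g z * fderiv ℝ h z e) / h z ^ 2 := by
  simp only [div_eq_mul_inv]
  rw [fderiv_mul_apply_of_differentiableAt hg (hh.fun_inv h0),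
    fderiv_inv_apply_of_differentiableAt hh h0]
  field_simp
  ring

/-- The derivative along `e` of the `e`-component of `(p u₀²)⁻¹ ∇(u₀ v)`, in terms of the fluxes
of `u₀` and `v`. -/
lemma fderiv_fderiv_mul_div_apply {S : Set E} (hS : IsOpen S) {p u₀ v : E → ℝ}
    (hp : ContDiffOn ℝ 2 p S) (hppos : ∀ z ∈ S, 0 < p z) (hu₀ : ContDiffOn ℝ 2 u₀ S)
    (hu₀pos : ∀ z ∈ S, 0 < u₀ z) (hv : ContDiffOn ℝ 2 v S) (e : E) {z : E} (hz : z ∈ S) :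
    fderiv ℝ (fun w => fderiv ℝ (fun t => u₀ t * v t) w e / (p w * u₀ w ^ 2)) z e =
      fderiv ℝ (fun w => (p w)⁻¹ * fderiv ℝ v w e) z e / u₀ z +
      v z / (p z * u₀ z) ^ 2 * (fderiv ℝ (fun w => p w * fderiv ℝ u₀ w e) z e -
        2 * fderiv ℝ p z e * fderiv ℝ u₀ z e - 2 * p z * fderiv ℝ u₀ z e ^ 2 / u₀ z) := by
  have hz' := hS.mem_nhds hz
  have dp : DifferentiableOn ℝ p S := hp.differentiableOn (by norm_num)
  have du : DifferentiableOn ℝ u₀ S := hu₀.differentiableOn (by norm_num)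
  have dv : DifferentiableOn ℝ v S := hv.differentiableOn (by norm_num)
  have dpz := dp.differentiableAt hz'
  have duz := du.differentiableAt hz'
  have dvz := dv.differentiableAt hz'
  have dduz := (hu₀.differentiableOn_fderiv_apply hS e).differentiableAt hz'
  have ddvz := (hv.differentiableOn_fderiv_apply hS e).differentiableAt hz'
  have hpz := (hppos z hz).ne'
  have huz := (hu₀pos z hz).ne'
  have hev : (fun w => fderiv ℝ (fun t => u₀ t * v t) w e / (p w * u₀ w ^ 2)) =ᶠ[nhds z]
      fun w => (u₀ w * fderiv ℝ v w e + v w * fderiv ℝ u₀ w e) / (p w * (u₀ w * u₀ w)) := by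
    filter_upwards [hz'] with w hw
    have hw' := hS.mem_nhds hw
    rw [fderiv_mul_apply_of_differentiableAt (du.differentiableAt hw') (dv.differentiableAt hw'),
      sq]
  rw [hev.fderiv_eq, fderiv_div_apply_of_differentiableAt (by fun_prop) (by fun_prop)
      (by positivity), fderiv_fun_add (by fun_prop) (by fun_prop), add_apply,
    fderiv_mul_apply_of_differentiableAt duz ddvz, fderiv_mul_apply_of_differentiableAt dvz dduz,
    fderiv_mul_apply_of_differentiableAt dpz (by fun_prop),
    fderiv_mul_apply_of_differentiableAt duz duz,
    fderiv_mul_apply_of_differentiableAt (dpz.fun_inv hpz) ddvz,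
    fderiv_mul_apply_of_differentiableAt dpz dduz, fderiv_inv_apply_of_differentiableAt dpz hpz]
  field_simp
  ring

/-- The derivative along `e` of the flux of `u₀ φ`, when the derivative of `φ` along `e` is
`(p u₀²)⁻¹ G`. -/
lemma fderiv_mul_fderiv_mul_apply {S : Set E} (hS : IsOpen S) {p u₀ φ G : E → ℝ}
    (hp : ContDiffOn ℝ 2 p S) (hppos : ∀ z ∈ S, 0 < p z) (hu₀ : ContDiffOn ℝ 2 u₀ S)
    (hu₀pos : ∀ z ∈ S, 0 < u₀ z) (hφ : DifferentiableOn ℝ φ S) (hG : DifferentiableOn ℝ G S)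
    {e : E} (hφG : ∀ z ∈ S, fderiv ℝ φ z e = G z / (p z * u₀ z ^ 2)) {z : E} (hz : z ∈ S) :
    fderiv ℝ (fun w => p w * fderiv ℝ (fun t => u₀ t * φ t) w e) z e =
      φ z * fderiv ℝ (fun w => p w * fderiv ℝ u₀ w e) z e + fderiv ℝ G z e / u₀ z := by
  have hz' := hS.mem_nhds hz
  have dp : DifferentiableOn ℝ p S := hp.differentiableOn (by norm_num)
  have du : DifferentiableOn ℝ u₀ S := hu₀.differentiableOn (by norm_num)
  have dpz := dp.differentiableAt hz'
  have duz := du.differentiableAt hz'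
  have dφz := hφ.differentiableAt hz'
  have dGz := hG.differentiableAt hz'
  have dduz := (hu₀.differentiableOn_fderiv_apply hS e).differentiableAt hz'
  have hpz := (hppos z hz).ne'
  have huz := (hu₀pos z hz).ne'
  have hev : (fun w => p w * fderiv ℝ (fun t => u₀ t * φ t) w e) =ᶠ[nhds z]
      fun w => φ w * (p w * fderiv ℝ u₀ w e) + G w / u₀ w := by
    filter_upwards [hz'] with w hw
    have hw' := hS.mem_nhds hw
    have hpw := (hppos w hw).ne'
    have huw := (hu₀pos w hw).ne'
    rw [fderiv_mul_apply_of_differentiableAt (du.differentiableAt hw') (hφ.differentiableAt hw'),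
      hφG w hw]
    field_simp
    ring
  rw [hev.fderiv_eq, fderiv_fun_add (by fun_prop) ((hG.div_of_ne_zero du fun w hw => (hu₀pos w hw).ne').differentiableAt hz'),
    add_apply,
    fderiv_mul_apply_of_differentiableAt dφz (by fun_prop),
    fderiv_div_apply_of_differentiableAt dGz duz huz, hφG z hz]
  field_simp
  ring

lemma fderiv_ofReal_add_I_mul_ofReal_apply {a b : E → ℝ} {z : E} (ha : DifferentiableAt ℝ a z)
    (hb : DifferentiableAt ℝ b z) (e : E) :
    fderiv ℝ (fun w => (a w : ℂ) + I * (b w : ℂ)) z e =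
      (fderiv ℝ a z e : ℂ) + I * (fderiv ℝ b z e : ℂ) := by
  have h : HasFDerivAt (fun w => (a w : ℂ) + I * (b w : ℂ)) _ z :=
    (ofRealCLM.hasFDerivAt.comp z ha.hasFDerivAt).add
      ((ofRealCLM.hasFDerivAt.comp z hb.hasFDerivAt).const_mul I)
  rw [h.fderiv]
  simp

end DirectionalDerivatives

lemma dzbar_ofReal_add_I_mul_ofReal {a b : ℝ × ℝ → ℝ} {z : ℝ × ℝ} (ha : DifferentiableAt ℝ a z)
    (hb : DifferentiableAt ℝ b z) :
    dzbar (fun w => (a w : ℂ) + I * (b w : ℂ)) z =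
      1 / 2 * ((rpdx a z - rpdy b z : ℝ) + I * (rpdy a z + rpdx b z : ℝ)) := by
  simp only [dzbar, pdx, pdy, rpdx, rpdy, fderiv_ofReal_add_I_mul_ofReal_apply ha hb]
  push_cast
  linear_combination (1 / 2 * (fderiv ℝ b z (0, 1) : ℂ)) * I_mul_I

lemma dzbar_cof {a : ℝ × ℝ → ℝ} {z : ℝ × ℝ} (ha : DifferentiableAt ℝ a z) :
    dzbar (cof a) z = 1 / 2 * ((rpdx a z : ℂ) + I * (rpdy a z : ℂ)) := by
  have h := dzbar_ofReal_add_I_mul_ofReal ha (differentiableAt_const (c := (0 : ℝ)) (x := z))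
  simpa [rpdx, rpdy, cof, Function.comp_def, show cof a = fun w => (a w : ℂ) from rfl] using h

/-- on an open rectangle, given a solution `v` of `div((1/p) grad v) + q₁ v = 0`,
the function `u = −u₀·Ā[i p^{−1} u₀^{−2} ∂_z̄(u₀ v)]` solves `div(p grad u) + qu = 0`, and
`W = p^{1/2}u + i p^{−1/2}v` solves the main Vekua equation with `f = p^{1/2}u₀`. -/
theorem statement7 (a₁ a₂ b₁ b₂ : ℝ)
    (p q u₀ : ℝ × ℝ → ℝ)
    (hp : ContDiffOn ℝ 2 p (Set.Ioo a₁ a₂ ×ˢ Set.Ioo b₁ b₂))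
    (hppos : ∀ z ∈ Set.Ioo a₁ a₂ ×ˢ Set.Ioo b₁ b₂, 0 < p z)
    (hu₀ : ContDiffOn ℝ 2 u₀ (Set.Ioo a₁ a₂ ×ˢ Set.Ioo b₁ b₂))
    (hu₀pos : ∀ z ∈ Set.Ioo a₁ a₂ ×ˢ Set.Ioo b₁ b₂, 0 < u₀ z)
    (hu₀sol : ∀ z ∈ Set.Ioo a₁ a₂ ×ˢ Set.Ioo b₁ b₂, divPgrad p u₀ z + q z * u₀ z = 0)
    (f : ℝ × ℝ → ℝ) (hf : ∀ z, f z = Real.sqrt (p z) * u₀ z)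
    (q₁ : ℝ × ℝ → ℝ)
    (hq₁ : ∀ z ∈ Set.Ioo a₁ a₂ ×ˢ Set.Ioo b₁ b₂,
      q₁ z = -(1 / p z) * (q z / p z +
        2 * (rpdx p z / p z * (rpdx u₀ z / u₀ z) + rpdy p z / p z * (rpdy u₀ z / u₀ z)) +
        2 * ((rpdx u₀ z / u₀ z) ^ 2 + (rpdy u₀ z / u₀ z) ^ 2)))
    (v : ℝ × ℝ → ℝ) (hv : ContDiffOn ℝ 2 v (Set.Ioo a₁ a₂ ×ˢ Set.Ioo b₁ b₂))
    (hvsol : ∀ z ∈ Set.Ioo a₁ a₂ ×ˢ Set.Ioo b₁ b₂,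
      divPgrad (fun w => (p w)⁻¹) v z + q₁ z * v z = 0)
    (Ψ₁ Ψ₂ : ℝ × ℝ → ℝ)
    (hΨ : ∀ w, (Ψ₁ w : ℂ) + Complex.I * (Ψ₂ w : ℂ) =
      Complex.I * ((p w : ℂ))⁻¹ * (((u₀ w : ℂ)) ^ 2)⁻¹ * dzbar (cof (fun v' => u₀ v' * v v')) w)
    (x₀ y₀ : ℝ) (h₀ : (x₀, y₀) ∈ Set.Ioo a₁ a₂ ×ˢ Set.Ioo b₁ b₂) (c : ℝ)
    (u : ℝ × ℝ → ℝ)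
    (hu : ∀ x y : ℝ, u (x, y) = -u₀ (x, y) *
      (2 * ((∫ η in x₀..x, Ψ₁ (η, y)) + ∫ ξ in y₀..y, Ψ₂ (x₀, ξ)) + c))
    (W : ℝ × ℝ → ℂ)
    (hW : ∀ z, W z = ((Real.sqrt (p z) * u z : ℝ) : ℂ) +
      Complex.I * (((Real.sqrt (p z))⁻¹ * v z : ℝ) : ℂ)) :
    ∀ z ∈ Set.Ioo a₁ a₂ ×ˢ Set.Ioo b₁ b₂,
      divPgrad p u z + q z * u z = 0 ∧
      dzbar W z = dzbar (cof f) z / (cof f z) * (starRingEnd ℂ) (W z) := by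
  set S := Set.Ioo a₁ a₂ ×ˢ Set.Ioo b₁ b₂
  have hSo : IsOpen S := isOpen_Ioo.prod isOpen_Ioo
  have hSc : Convex ℝ S := (convex_Ioo a₁ a₂).prod (convex_Ioo b₁ b₂)
  have dp : DifferentiableOn ℝ p S := hp.differentiableOn (by norm_num)
  have du : DifferentiableOn ℝ u₀ S := hu₀.differentiableOn (by norm_num)
  have dv : DifferentiableOn ℝ v S := hv.differentiableOn (by norm_num)
  have hg : ContDiffOn ℝ 2 (fun t => u₀ t * v t) S := hu₀.mul hv
  have dg : DifferentiableOn ℝ (fun t => u₀ t * v t) S := du.mul dv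
  have dG := hg.differentiableOn_fderiv_apply hSo
  have hm0 : ∀ z ∈ S, p z * u₀ z ^ 2 ≠ 0 := fun z hz =>
    (mul_pos (hppos z hz) (pow_pos (hu₀pos z hz) 2)).ne'
  have dH : ∀ e, DifferentiableOn ℝ
      (fun z => fderiv ℝ (fun t => u₀ t * v t) z e / (p z * u₀ z ^ 2)) S := fun e =>
    (dG e).div_of_ne_zero (dp.fun_mul (du.fun_pow 2)) hm0
  have hΨ₁₂ : ∀ z ∈ S,
      Ψ₁ z = -(1 / 2) * (fderiv ℝ (fun t => u₀ t * v t) z (0, 1) / (p z * u₀ z ^ 2)) ∧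
      Ψ₂ z = 1 / 2 * (fderiv ℝ (fun t => u₀ t * v t) z (1, 0) / (p z * u₀ z ^ 2)) := by
    intro z hz
    have h := hΨ z
    rw [dzbar_cof (dg.differentiableAt (hSo.mem_nhds hz))] at h
    have h' : ((Ψ₁ z : ℝ) : ℂ) + I * (Ψ₂ z : ℝ) =
        ((-(1 / 2) * (rpdy (fun t => u₀ t * v t) z / (p z * u₀ z ^ 2)) : ℝ) : ℂ) +
        I * ((1 / 2 * (rpdx (fun t => u₀ t * v t) z / (p z * u₀ z ^ 2)) : ℝ) : ℂ) := by
      rw [h]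
      push_cast
      rw [div_eq_mul_inv, div_eq_mul_inv, mul_inv]
      linear_combination (1 / 2 * (rpdy (fun t => u₀ t * v t) z : ℂ) *
        ((p z : ℂ)⁻¹ * ((u₀ z : ℂ) ^ 2)⁻¹)) * I_mul_I
    have hre := congrArg Complex.re h'
    have him := congrArg Complex.im h'
    simp only [add_re, add_im, ofReal_re, ofReal_im, I_mul_re, I_mul_im, neg_zero, add_zero,
      zero_add] at hre him
    exact ⟨hre, him⟩
  have dΨ₁ : DifferentiableOn ℝ Ψ₁ S :=
    ((dH (0, 1)).const_mul (-(1 / 2))).congr fun z hz => (hΨ₁₂ z hz).1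
  have dΨ₂ : DifferentiableOn ℝ Ψ₂ S :=
    ((dH (1, 0)).const_mul (1 / 2)).congr fun z hz => (hΨ₁₂ z hz).2
  have hclosed : ∀ z ∈ S, rpdy Ψ₁ z = rpdx Ψ₂ z := by
    intro z hz
    have hz' := hSo.mem_nhds hz
    have e1 : Ψ₁ =ᶠ[nhds z] _ := Filter.eventually_of_mem hz' fun w hw => (hΨ₁₂ w hw).1
    have e2 : Ψ₂ =ᶠ[nhds z] _ := Filter.eventually_of_mem hz' fun w hw => (hΨ₁₂ w hw).2
    have hpz := (hppos z hz).ne'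
    have huz := (hu₀pos z hz).ne'
    rw [rpdy, rpdx, e1.fderiv_eq, e2.fderiv_eq,
      fderiv_const_mul ((dH (0, 1)).differentiableAt hz'),
      fderiv_const_mul ((dH (1, 0)).differentiableAt hz'),
      smul_apply, smul_apply, smul_eq_mul, smul_eq_mul,
      fderiv_fderiv_mul_div_apply hSo hp hppos hu₀ hu₀pos hv _ hz,
      fderiv_fderiv_mul_div_apply hSo hp hppos hu₀ hu₀pos hv _ hz]
    have h1 := hu₀sol z hz
    have h2 := hvsol z hz
    rw [hq₁ z hz] at h2
    simp only [divPgrad, rpdx, rpdy] at h1 h2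
    rw [← sub_eq_zero]
    have h1' := eq_neg_of_add_eq_zero_left h1
    have h2' := eq_neg_of_add_eq_zero_left h2
    rw [← eq_sub_iff_add_eq] at h1' h2'
    rw [h1', h2']
    field_simp
    ring
  obtain ⟨F, hF⟩ := exists_hasFDerivAt_of_rpdy_eq_rpdx hSc hSo dΨ₁ dΨ₂ hclosed
  set φ : ℝ × ℝ → ℝ := fun z => -(2 * (F z - F (x₀, y₀)) + c) with hφdef
  have huφ : ∀ z ∈ S, u z = u₀ z * φ z := by
    rintro ⟨x, y⟩ hz
    rw [hu, integral_add_integral_eq_sub_of_hasFDerivAt dΨ₁.continuousOn dΨ₂.continuousOn hF h₀ hz]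
    simp only [hφdef]
    ring
  have hφ' : ∀ z ∈ S, HasFDerivAt φ (-((2 : ℝ) • (Ψ₁ z • ContinuousLinearMap.fst ℝ ℝ ℝ +
      Ψ₂ z • ContinuousLinearMap.snd ℝ ℝ ℝ))) z := fun z hz =>
    ((((hF z hz).sub_const _).const_mul 2).add_const c).neg
  have dφ : DifferentiableOn ℝ φ S := fun z hz =>
    (hφ' z hz).differentiableAt.differentiableWithinAt
  have hφx : ∀ z ∈ S, fderiv ℝ φ z (1, 0) =
      fderiv ℝ (fun t => u₀ t * v t) z (0, 1) / (p z * u₀ z ^ 2) := by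
    intro z hz
    rw [(hφ' z hz).fderiv]
    simp [(hΨ₁₂ z hz).1]
  have hφy : ∀ z ∈ S, fderiv ℝ φ z (0, 1) =
      -fderiv ℝ (fun t => u₀ t * v t) z (1, 0) / (p z * u₀ z ^ 2) := by
    intro z hz
    rw [(hφ' z hz).fderiv]
    simp [(hΨ₁₂ z hz).2, neg_div]
  intro z hz
  have hz' := hSo.mem_nhds hz
  have dpz := dp.differentiableAt hz'
  have duz := du.differentiableAt hz'
  have dvz := dv.differentiableAt hz'
  have dφz := dφ.differentiableAt hz'
  have hpz := hppos z hz
  have huz := (hu₀pos z hz).ne'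
  constructor
  · have hflux : ∀ e, (fun w => p w * fderiv ℝ u w e) =ᶠ[nhds z]
        fun w => p w * fderiv ℝ (fun t => u₀ t * φ t) w e := by
      intro e
      filter_upwards [hz'] with w hw
      have : u =ᶠ[nhds w] fun t => u₀ t * φ t := Filter.eventually_of_mem (hSo.mem_nhds hw) huφ
      rw [this.fderiv_eq]
    have hsymm : fderiv ℝ (fun w => fderiv ℝ (fun t => u₀ t * v t) w (0, 1)) z (1, 0) =
        fderiv ℝ (fun w => fderiv ℝ (fun t => u₀ t * v t) w (1, 0)) z (0, 1) := by
      have hd : DifferentiableAt ℝ (fderiv ℝ (fun t => u₀ t * v t)) z :=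
        ((hg.fderiv_of_isOpen hSo (m := 1) (by norm_num)).differentiableOn
          (by norm_num)).differentiableAt hz'
      have hs := (hg.contDiffAt hz').isSymmSndFDerivAt (by simp)
      have hap : ∀ e e', fderiv ℝ (fun w => fderiv ℝ (fun t => u₀ t * v t) w e) z e' =
          fderiv ℝ (fderiv ℝ (fun t => u₀ t * v t)) z e' e := fun e e' => by
        simp [fderiv_clm_apply hd (differentiableAt_const e)]
      rw [hap, hap]
      exact hs _ _
    have h1 := hu₀sol z hz
    simp only [divPgrad, rpdx, rpdy] at h1 ⊢
    rw [(hflux _).fderiv_eq, (hflux _).fderiv_eq,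
      fderiv_mul_fderiv_mul_apply hSo hp hppos hu₀ hu₀pos dφ (dG (0, 1)) hφx hz,
      fderiv_mul_fderiv_mul_apply hSo hp hppos hu₀ hu₀pos dφ (dG (1, 0)).fun_neg hφy hz,
      fderiv_fun_neg, neg_apply, hsymm, huφ z hz]
    linear_combination φ z * h1
  · have hR : √(p z) ≠ 0 := (Real.sqrt_pos.2 hpz).ne'
    have hRp : p z = √(p z) ^ 2 := (Real.sq_sqrt hpz.le).symm
    have dR : DifferentiableAt ℝ (fun w => √(p w)) z := dpz.sqrt hpz.ne'
    have hf' : f = fun w => √(p w) * u₀ w := funext hf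
    have hW' : W =ᶠ[nhds z] fun w => ((√(p w) * (u₀ w * φ w) : ℝ) : ℂ) +
        I * (((√(p w))⁻¹ * v w : ℝ) : ℂ) := by
      filter_upwards [hz'] with w hw
      rw [hW, huφ w hw]
    have hdW : dzbar W z = dzbar (fun w => ((√(p w) * (u₀ w * φ w) : ℝ) : ℂ) +
        I * (((√(p w))⁻¹ * v w : ℝ) : ℂ)) z := by
      simp only [dzbar, pdx, pdy, hW'.fderiv_eq]
    rw [hdW, dzbar_ofReal_add_I_mul_ofReal (by fun_prop) ((dR.fun_inv hR).fun_mul dvz), hf',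
      dzbar_cof (by fun_prop), hW, huφ z hz]
    have hgx := fun e => fderiv_mul_apply_of_differentiableAt duz dvz e
    simp only [rpdx, rpdy, cof, fderiv_mul_apply_of_differentiableAt dR (duz.fun_mul dφz),
      fderiv_mul_apply_of_differentiableAt duz dφz,
      fderiv_mul_apply_of_differentiableAt (dR.fun_inv hR) dvz,
      fderiv_mul_apply_of_differentiableAt dR duz,
      fderiv_inv_apply_of_differentiableAt dR hR, hφx z hz, hφy z hz, hgx]
    generalize fderiv ℝ (fun w => √(p w)) z = dr
    rw [hRp]
    simp only [Real.sqrt_sq (Real.sqrt_nonneg _)]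
    generalize √(p z) = r at hR
    have hRC : (r : ℂ) ≠ 0 := ofReal_ne_zero.2 hR
    have huC : (u₀ z : ℂ) ≠ 0 := ofReal_ne_zero.2 huz
    simp only [map_add, map_mul, conj_ofReal, conj_I]
    push_cast
    field_simp
    ring_nf
    simp only [I_sq]
    ring
end

section
/- Let Ω ⊂ ℝ² be open and let f : Ω → ℝ be a twice continuously differentiable real-valued function with f > 0 on Ω. If W : Ω → ℂ is a twice continuously differentiable solution of the main Vekua equation ∂_z̄ W = (∂_z̄ f / f)·conj(W) on Ω, then the function w = ∂_z W − (∂_z f / f)·conj(W) is a solution of the equation ∂_z̄ w + (∂_z f / f)·conj(w) = 0 on Ω. -/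
open Complex

section Wirtinger

variable {u v : ℝ × ℝ → ℂ} {z : ℝ × ℝ}

theorem dz_congr (h : u =ᶠ[nhds z] v) : dz u z = dz v z := by
  simp only [dz, pdx, pdy, h.fderiv_eq]

theorem dzbar_congr (h : u =ᶠ[nhds z] v) : dzbar u z = dzbar v z := by
  simp only [dzbar, pdx, pdy, h.fderiv_eq]

theorem dz_mul (hu : DifferentiableAt ℝ u z) (hv : DifferentiableAt ℝ v z) :
    dz (fun w => u w * v w) z = dz u z * v z + u z * dz v z := by
  simp only [dz, pdx, pdy, fderiv_fun_mul hu hv, add_apply, smul_apply, smul_eq_mul]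
  ring

theorem dzbar_mul (hu : DifferentiableAt ℝ u z) (hv : DifferentiableAt ℝ v z) :
    dzbar (fun w => u w * v w) z = dzbar u z * v z + u z * dzbar v z := by
  simp only [dzbar, pdx, pdy, fderiv_fun_mul hu hv, add_apply, smul_apply, smul_eq_mul]
  ring

theorem dzbar_sub (hu : DifferentiableAt ℝ u z) (hv : DifferentiableAt ℝ v z) :
    dzbar (fun w => u w - v w) z = dzbar u z - dzbar v z := by
  simp only [dzbar, pdx, pdy, fderiv_fun_sub hu hv, sub_apply]
  ring

theorem fderiv_starRingEnd (hu : DifferentiableAt ℝ u z) (e : ℝ × ℝ) :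
    fderiv ℝ (fun w => (starRingEnd ℂ) (u w)) z e = (starRingEnd ℂ) (fderiv ℝ u z e) := by
  have h := (conjCLE.toContinuousLinearMap.hasFDerivAt (x := u z)).comp z hu.hasFDerivAt
  have h' : HasFDerivAt (fun w => (starRingEnd ℂ) (u w)) _ z := h
  rw [h'.fderiv]
  simp

theorem dz_starRingEnd (hu : DifferentiableAt ℝ u z) :
    dz (fun w => (starRingEnd ℂ) (u w)) z = (starRingEnd ℂ) (dzbar u z) := by
  simp only [dz, dzbar, pdx, pdy, fderiv_starRingEnd hu, map_mul, map_add, conj_I, map_div₀,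
    map_one, map_ofNat]
  ring

theorem dzbar_starRingEnd (hu : DifferentiableAt ℝ u z) :
    dzbar (fun w => (starRingEnd ℂ) (u w)) z = (starRingEnd ℂ) (dz u z) := by
  simp only [dz, dzbar, pdx, pdy, fderiv_starRingEnd hu, map_mul, map_sub, conj_I, map_div₀,
    map_one, map_ofNat]
  ring

theorem ContDiffAt.differentiableAt_fderiv_apply (hu : ContDiffAt ℝ 2 u z) (e : ℝ × ℝ) :
    DifferentiableAt ℝ (fun w => fderiv ℝ u w e) z :=
  ((hu.fderiv_right (m := 1) (by norm_num)).differentiableAt (by norm_num)).clm_apply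
    (differentiableAt_const e)

theorem ContDiffAt.differentiableAt_dz (hu : ContDiffAt ℝ 2 u z) :
    DifferentiableAt ℝ (dz u) z :=
  ((hu.differentiableAt_fderiv_apply _).sub
    ((hu.differentiableAt_fderiv_apply _).const_mul I)).const_mul (1 / 2)

theorem ContDiffAt.differentiableAt_dzbar (hu : ContDiffAt ℝ 2 u z) :
    DifferentiableAt ℝ (dzbar u) z :=
  ((hu.differentiableAt_fderiv_apply _).add
    ((hu.differentiableAt_fderiv_apply _).const_mul I)).const_mul (1 / 2)

theorem ContDiffAt.dzbar_dz_comm (hu : ContDiffAt ℝ 2 u z) :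
    dzbar (dz u) z = dz (dzbar u) z := by
  have hx := hu.differentiableAt_fderiv_apply (1, 0)
  have hy := hu.differentiableAt_fderiv_apply (0, 1)
  have hz : HasFDerivAt (dz u) _ z :=
    (hx.hasFDerivAt.sub (hy.hasFDerivAt.const_mul I)).const_mul (1 / 2)
  have hzbar : HasFDerivAt (dzbar u) _ z :=
    (hx.hasFDerivAt.add (hy.hasFDerivAt.const_mul I)).const_mul (1 / 2)
  have hd : DifferentiableAt ℝ (fderiv ℝ u) z :=
    (hu.fderiv_right (m := 1) (by norm_num)).differentiableAt (by norm_num)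
  have happ (e e' : ℝ × ℝ) :
      fderiv ℝ (fun w => fderiv ℝ u w e) z e' = fderiv ℝ (fderiv ℝ u) z e' e := by
    rw [fderiv_clm_apply hd (differentiableAt_const e)]
    simp
  have hsymm : fderiv ℝ (fderiv ℝ u) z (1, 0) (0, 1) = fderiv ℝ (fderiv ℝ u) z (0, 1) (1, 0) :=
    hu.isSymmSndFDerivAt (by simp) (1, 0) (0, 1)
  rw [dzbar, dz]
  simp only [pdx, pdy, hz.fderiv, hzbar.fderiv, add_apply, sub_apply, smul_apply, smul_eq_mul,
    happ, hsymm]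
  ring

end Wirtinger

section LogarithmicDerivative

variable {f : ℝ × ℝ → ℝ} {z : ℝ × ℝ}

theorem fderiv_cof (hf : DifferentiableAt ℝ f z) (e : ℝ × ℝ) :
    fderiv ℝ (cof f) z e = ((fderiv ℝ f z e : ℝ) : ℂ) := by
  have h : HasFDerivAt (cof f) _ z := ofRealCLM.hasFDerivAt.comp z hf.hasFDerivAt
  rw [h.fderiv]
  simp

theorem fderiv_cof_log (hf : DifferentiableAt ℝ f z) (hz : f z ≠ 0) (e : ℝ × ℝ) :
    fderiv ℝ (cof fun w => Real.log (f w)) z e = fderiv ℝ (cof f) z e / cof f z := by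
  rw [fderiv_cof (hf.log hz), fderiv_cof hf, fderiv.log hf hz]
  simp [cof, div_eq_inv_mul]

theorem dz_cof_log (hf : DifferentiableAt ℝ f z) (hz : f z ≠ 0) :
    dz (cof fun w => Real.log (f w)) z = dz (cof f) z / cof f z := by
  simp only [dz, pdx, pdy, fderiv_cof_log hf hz]
  ring

theorem dzbar_cof_log (hf : DifferentiableAt ℝ f z) (hz : f z ≠ 0) :
    dzbar (cof fun w => Real.log (f w)) z = dzbar (cof f) z / cof f z := by
  simp only [dzbar, pdx, pdy, fderiv_cof_log hf hz]
  ring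

theorem starRingEnd_dz_cof (hf : DifferentiableAt ℝ f z) :
    (starRingEnd ℂ) (dz (cof f) z) = dzbar (cof f) z := by
  simp only [dz, dzbar, pdx, pdy, fderiv_cof hf, map_mul, map_sub, conj_I, conj_ofReal, map_div₀,
    map_one, map_ofNat]
  ring

theorem starRingEnd_dzbar_cof (hf : DifferentiableAt ℝ f z) :
    (starRingEnd ℂ) (dzbar (cof f) z) = dz (cof f) z := by
  rw [← starRingEnd_dz_cof hf, conj_conj]

theorem ContDiffAt.cof {n : WithTop ℕ∞} (hf : ContDiffAt ℝ n f z) :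
    ContDiffAt ℝ n (cof f) z :=
  ofRealCLM.contDiff.contDiffAt.comp z hf

end LogarithmicDerivative

/-- if `W` solves the main Vekua equation `∂_z̄ W = (∂_z̄ f/f)·conj W`, then
`w = ∂_z W − (∂_z f/f)·conj W` solves `∂_z̄ w + (∂_z f/f)·conj w = 0` on `Ω`. -/
theorem statement12 (Ω : Set (ℝ × ℝ)) (hΩ : IsOpen Ω)
    (f : ℝ × ℝ → ℝ) (hf : ContDiffOn ℝ 2 f Ω) (hfpos : ∀ z ∈ Ω, 0 < f z)
    (W : ℝ × ℝ → ℂ) (hW : ContDiffOn ℝ 2 W Ω)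
    (hVekua : ∀ z ∈ Ω, dzbar W z = dzbar (cof f) z / (cof f z) * (starRingEnd ℂ) (W z)) :
    ∀ z ∈ Ω,
      dzbar (fun w => dz W w - dz (cof f) w / (cof f w) * (starRingEnd ℂ) (W w)) z +
        dz (cof f) z / (cof f z) *
          (starRingEnd ℂ)
            (dz W z - dz (cof f) z / (cof f z) * (starRingEnd ℂ) (W z)) = 0 := by
  intro z hz
  set φ : ℝ × ℝ → ℝ := fun w => Real.log (f w)
  have hfd {w : ℝ × ℝ} (hw : w ∈ Ω) : DifferentiableAt ℝ f w :=
    (hf.contDiffAt (hΩ.mem_nhds hw)).differentiableAt (by norm_num)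
  have hdz {w : ℝ × ℝ} (hw : w ∈ Ω) : dz (cof f) w / cof f w = dz (cof φ) w :=
    (dz_cof_log (hfd hw) (hfpos w hw).ne').symm
  have hdzbar {w : ℝ × ℝ} (hw : w ∈ Ω) : dzbar (cof f) w / cof f w = dzbar (cof φ) w :=
    (dzbar_cof_log (hfd hw) (hfpos w hw).ne').symm
  have hWz := hW.contDiffAt (hΩ.mem_nhds hz)
  have hWd : DifferentiableAt ℝ W z := hWz.differentiableAt (by norm_num)
  have hWconj : DifferentiableAt ℝ (fun w => (starRingEnd ℂ) (W w)) z :=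
    conjCLE.toContinuousLinearMap.differentiableAt.comp z hWd
  have hφz : ContDiffAt ℝ 2 φ z := (hf.contDiffAt (hΩ.mem_nhds hz)).log (hfpos z hz).ne'
  have hφd : DifferentiableAt ℝ φ z := hφz.differentiableAt (by norm_num)
  have hw : (fun w => dz W w - dz (cof f) w / cof f w * (starRingEnd ℂ) (W w))
      =ᶠ[nhds z] fun w => dz W w - dz (cof φ) w * (starRingEnd ℂ) (W w) := by
    filter_upwards [hΩ.mem_nhds hz] with w hw
    rw [hdz hw]
  have hV : dzbar W =ᶠ[nhds z] fun w => dzbar (cof φ) w * (starRingEnd ℂ) (W w) := by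
    filter_upwards [hΩ.mem_nhds hz] with w hw
    rw [hVekua w hw, hdzbar hw]
  have hφdz := hφz.cof.differentiableAt_dz
  rw [dzbar_congr hw, dzbar_sub hWz.differentiableAt_dz (hφdz.fun_mul hWconj),
    dzbar_mul hφdz hWconj, hWz.dzbar_dz_comm, dz_congr hV,
    dz_mul hφz.cof.differentiableAt_dzbar hWconj, dz_starRingEnd hWd, dzbar_starRingEnd hWd,
    hφz.cof.dzbar_dz_comm, hV.eq_of_nhds, hdz hz]
  simp only [map_mul, map_sub, conj_conj, starRingEnd_dz_cof hφd, starRingEnd_dzbar_cof hφd]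
  ring
end
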